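/- arXiv:1703.08312 — 2 statements merged into one kernel-verified Lean document; each statement's English description precedes it below -/
import Mathlib

section
/- Let q be an odd prime power and let g be an integer with g ≥ max{(q−3)/2, 2}. Then there exists a squarefree polynomial H ∈ F_q[X] of degree 2g+2 whose leading coefficient is a non-square in F_q and such that H(x) is a non-square in F_q for every x ∈ F_q. (Such an H is precisely an affine model y² = H(x) of a smooth pointless hyperelliptic curve of genus g over F_q: the value condition rules out affine rational points and the leading-coefficient condition rules out rational points at infinity.) -/
open Polynomial

namespace PointlessHyperelliptic

variable {F : Type*} [Field F]

/-- Over a field, a polynomial sharing no root with its derivative in the algebraic closure is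
squarefree. -/
lemma squarefree_of_no_common_root (N : F[X])
    (h : ∀ α : AlgebraicClosure F, aeval α N = 0 → aeval α (derivative N) = 0 → False) :
    Squarefree N := by
  apply Separable.squarefree
  rw [Separable, isCoprime_iff_aeval_ne_zero_of_isAlgClosed F (AlgebraicClosure F)]
  intro α
  by_contra! hα
  exact h α hα.1 hα.2

/-- Multiplying by a non-square turns a polynomial with nonzero square values and nonzero square
leading coefficient into one with non-square values and non-square leading coefficient. -/
lemma exists_nonsquare_valued_of_square_valued [Fintype F] (hodd : Odd (Fintype.card F))
    {N : F[X]} {n : ℕ} (hsq : Squarefree N) (hdeg : N.natDegree = n)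
    (hlead : ∃ c : F, c ≠ 0 ∧ N.leadingCoeff = c ^ 2)
    (hval : ∀ x : F, ∃ c : F, c ≠ 0 ∧ N.eval x = c ^ 2) :
    ∃ H : F[X], Squarefree H ∧ H.natDegree = n ∧ (¬ ∃ y : F, H.leadingCoeff = y ^ 2) ∧
      ∀ x : F, ¬ ∃ y : F, H.eval x = y ^ 2 := by
  have hchar : ringChar F ≠ 2 := fun h => by
    have := FiniteField.even_card_of_char_two h
    rw [← Nat.not_even_iff_odd, Nat.even_iff] at hodd
    exact hodd this
  obtain ⟨ν, hν⟩ := FiniteField.exists_nonsquare hchar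
  have hν0 : ν ≠ 0 := by
    rintro rfl
    exact hν ⟨0, by simp⟩
  have key : ∀ c : F, c ≠ 0 → ¬ ∃ y : F, ν * c ^ 2 = y ^ 2 := by
    rintro c hc ⟨y, hy⟩
    refine hν ⟨y / c, ?_⟩
    field_simp
    exact hy
  refine ⟨C ν * N, ?_, ?_, ?_, fun x => ?_⟩
  · have hu : IsUnit (C ν) := isUnit_C.2 hν0.isUnit
    exact hsq.squarefree_of_dvd (hu.mul_left_dvd.2 dvd_rfl)
  · rw [natDegree_C_mul hν0, hdeg]
  · obtain ⟨c, hc, h⟩ := hlead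
    rw [leadingCoeff_mul, leadingCoeff_C, h]
    exact key c hc
  · obtain ⟨c, hc, h⟩ := hval x
    rw [eval_mul, eval_C, h]
    exact key c hc

/-- The polynomial `X ^ k * (X ^ r - 1) + e * X ^ r + d`; for `r = q - 1` it takes the value `d`
at `0` and `d + e` elsewhere on `𝔽_q`. -/
noncomputable def twoValued (k r : ℕ) (e d : F) : F[X] :=
  X ^ k * (X ^ r - 1) + C e * X ^ r + C d

lemma twoValued_eq (k r : ℕ) (e d : F) :
    twoValued k r e d = X ^ (k + r) + (C e * X ^ r + (C d - X ^ k)) := by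
  rw [twoValued]
  ring

lemma twoValued_degree_aux {k r : ℕ} (hk : 0 < k) (hr : 0 < r) (e d : F) :
    (C e * X ^ r + (C d - X ^ k) : F[X]).degree < (k + r : ℕ) := by
  have h1 : (C e * X ^ r : F[X]).degree < (k + r : ℕ) :=
    (degree_C_mul_X_pow_le r e).trans_lt (by exact_mod_cast (by omega : r < k + r))
  have h2 : (C d : F[X]).degree < (k + r : ℕ) :=
    degree_C_le.trans_lt (by exact_mod_cast (by omega : 0 < k + r))
  have h3 : (X ^ k : F[X]).degree < (k + r : ℕ) := by
    rw [degree_X_pow]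
    exact_mod_cast (by omega : k < k + r)
  exact (degree_add_le _ _).trans_lt
    (max_lt h1 ((degree_sub_le _ _).trans_lt (max_lt h2 h3)))

lemma monic_twoValued {k r : ℕ} (hk : 0 < k) (hr : 0 < r) (e d : F) :
    (twoValued k r e d).Monic := by
  rw [twoValued_eq]
  exact monic_X_pow_add (twoValued_degree_aux hk hr e d)

lemma natDegree_twoValued {k r : ℕ} (hk : 0 < k) (hr : 0 < r) (e d : F) :
    (twoValued k r e d).natDegree = k + r := by
  apply natDegree_eq_of_degree_eq_some
  rw [twoValued_eq, degree_add_eq_left_of_degree_lt, degree_X_pow]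
  rw [degree_X_pow]
  exact twoValued_degree_aux hk hr e d

lemma exists_of_squarefree_twoValued [Fintype F] (hodd : Odd (Fintype.card F)) {k r : ℕ}
    (hr : Fintype.card F = r + 1) (hr0 : 0 < r) (hk : 0 < k) {e d s t : F}
    (hs : s ≠ 0) (ht : t ≠ 0) (hd : d = s ^ 2) (hde : d + e = t ^ 2)
    (hsq : Squarefree (twoValued k r e d)) :
    ∃ H : F[X], Squarefree H ∧ H.natDegree = k + r ∧ (¬ ∃ y : F, H.leadingCoeff = y ^ 2) ∧
      ∀ x : F, ¬ ∃ y : F, H.eval x = y ^ 2 := by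
  refine exists_nonsquare_valued_of_square_valued hodd hsq (natDegree_twoValued hk hr0 e d)
    ⟨1, one_ne_zero, by rw [(monic_twoValued hk hr0 e d).leadingCoeff, one_pow]⟩ fun x => ?_
  by_cases hx : x = 0
  · refine ⟨s, hs, ?_⟩
    simp [twoValued, hx, hr0.ne', hk.ne', hd]
  · refine ⟨t, ht, ?_⟩
    have := FiniteField.pow_card_sub_one_eq_one x hx
    rw [hr, Nat.add_sub_cancel] at this
    simp [twoValued, this, ← hde, add_comm]

/-- The equations satisfied by a multiple root of `twoValued`. -/
lemma squarefree_twoValued {k r : ℕ} (hr : (r : F) = -1) (hr0 : 0 < r) (hk : 0 < k) {e d : F}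
    (hd : d ≠ 0)
    (h : ∀ α : AlgebraicClosure F, α ≠ 0 →
      α ^ k * (α ^ r - 1) + algebraMap F _ e * α ^ r + algebraMap F _ d = 0 →
      α ^ k * ((k - 1) * α ^ r - k) = algebraMap F _ e * α ^ r → False) :
    Squarefree (twoValued k r e d) := by
  have hrK : (r : AlgebraicClosure F) = -1 := by
    have := congrArg (algebraMap F (AlgebraicClosure F)) hr
    simpa using this
  refine squarefree_of_no_common_root _ fun α h0 h1 => ?_
  have h0' : α ^ k * (α ^ r - 1) + algebraMap F _ e * α ^ r + algebraMap F _ d = 0 := by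
    simpa [twoValued] using h0
  have hα : α ≠ 0 := by
    rintro rfl
    simp [hr0.ne', hk.ne'] at h0'
    exact hd h0'
  refine h α hα h0' ?_
  obtain ⟨k, rfl⟩ : ∃ j, k = j + 1 := ⟨k - 1, by omega⟩
  obtain ⟨r, rfl⟩ : ∃ j, r = j + 1 := ⟨r - 1, by omega⟩
  simp only [twoValued, derivative_mul, derivative_C,
    derivative_X_pow, derivative_one, map_add, map_mul, map_sub, map_pow, aeval_X, aeval_C,
    Nat.add_sub_cancel, map_natCast, map_one, map_zero] at h1
  rw [hrK] at h1
  linear_combination α * h1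

/-- If `k * (k - 1) = 0` in the field, the constant-valued member is squarefree. -/
lemma squarefree_twoValued_zero {k r : ℕ} (hr : (r : F) = -1) (hr0 : 0 < r) (hk : 0 < k) {d : F}
    (hd : d ≠ 0)
    (h : ∀ α : AlgebraicClosure F, α ≠ 0 → (k : F) ≠ 0 → (k - 1 : F) ≠ 0 →
      ((k : AlgebraicClosure F) - 1) * α ^ r = k →
      α ^ k = - (k - 1) * algebraMap F _ d → False) :
    Squarefree (twoValued k r 0 d) := by
  refine squarefree_twoValued hr hr0 hk hd fun α hα h1 h2 => ?_
  rw [map_zero, zero_mul] at h2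
  have hT : ((k : AlgebraicClosure F) - 1) * α ^ r = k :=
    sub_eq_zero.1 ((mul_eq_zero.1 h2).resolve_left (pow_ne_zero k hα))
  rw [map_zero, zero_mul] at h1
  have hcast : algebraMap F (AlgebraicClosure F) k = k := map_natCast _ _
  refine h α hα ?_ ?_ hT ?_
  · intro h0
    have hk0 : (k : AlgebraicClosure F) = 0 := by rw [← hcast, h0, map_zero]
    rw [hk0] at hT
    apply pow_ne_zero r hα
    linear_combination -hT
  · intro h0
    have hk0 : (k : AlgebraicClosure F) = 1 := by
      rw [← hcast, sub_eq_zero.1 h0, map_one]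
    rw [hk0] at hT
    simp at hT
  · linear_combination ((k : AlgebraicClosure F) - 1) * h1 - α ^ k * hT

lemma eq_one_or_eq_neg_one_of_gcd_dvd_two {G : Type*} [Field G] {k r : ℕ}
    (hg : Nat.gcd k r ∣ 2) {x : G} (hk : x ^ k = 1) (hr : x ^ r = 1) : x = 1 ∨ x = -1 := by
  rw [← mul_self_eq_one_iff, ← sq]
  exact orderOf_dvd_iff_pow_eq_one.1
    ((Nat.dvd_gcd (orderOf_dvd_of_pow_eq_one hk) (orderOf_dvd_of_pow_eq_one hr)).trans hg)

lemma algebraMap_pow_eq_one [Fintype F] {r : ℕ} (hr : Fintype.card F = r + 1) {x : F}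
    (hx : x ≠ 0) : (algebraMap F (AlgebraicClosure F) x) ^ r = 1 := by
  have := FiniteField.pow_card_sub_one_eq_one x hx
  rw [hr, Nat.add_sub_cancel] at this
  rw [← map_pow, this, map_one]

/-- If `gcd (k, q - 1) ∤ 2`, some constant square-valued member is squarefree. -/
lemma exists_squarefree_of_not_gcd_dvd_two [Fintype F] {k r : ℕ}
    (hcard : Fintype.card F = r + 1) (hr : (r : F) = -1) (hr0 : 0 < r) (hk : 0 < k)
    (hg : ¬ Nat.gcd k r ∣ 2) :
    ∃ s : F, s ≠ 0 ∧ Squarefree (twoValued k r 0 (s ^ 2)) := by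
  classical
  by_contra! hcon
  obtain ⟨g, hgen⟩ := IsCyclic.exists_generator (α := Fˣ)
  have hord : orderOf g = r := by
    rw [orderOf_eq_card_of_forall_mem_zpowers hgen, Nat.card_units, Nat.card_eq_fintype_card,
      hcard, Nat.add_sub_cancel]
  have trouble : ∀ s : F, s ≠ 0 → ∃ α : AlgebraicClosure F, α ≠ 0 ∧ (k - 1 : F) ≠ 0 ∧
      ((k : AlgebraicClosure F) - 1) * α ^ r = k ∧
      α ^ k = - (k - 1) * algebraMap F _ (s ^ 2) := by
    intro s hs
    by_contra! hno
    exact hcon s hs (squarefree_twoValued_zero hr hr0 hk (pow_ne_zero 2 hs)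
      fun α h0 _ h2 h3 h4 => hno α h0 h2 h3 h4)
  obtain ⟨α, hα, hk1, hα1, hα2⟩ := trouble 1 one_ne_zero
  obtain ⟨β, hβ, -, hβ1, hβ2⟩ := trouble g g.ne_zero
  have hk1' : (k : AlgebraicClosure F) - 1 ≠ 0 := by
    have := (_root_.map_ne_zero (algebraMap F (AlgebraicClosure F))).2 hk1
    simpa using this
  have hy : (β / α) ^ r = 1 := by
    rw [div_pow, div_eq_one_iff_eq (pow_ne_zero r hα)]
    exact mul_left_cancel₀ hk1' (hβ1.trans hα1.symm)
  have hyk : (β / α) ^ k = algebraMap F _ ((g : F) ^ 2) := by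
    rw [div_pow, hβ2, hα2, one_pow, map_one]
    field_simp
  obtain ⟨a, ha⟩ := Nat.gcd_dvd_left k r
  obtain ⟨b, hb⟩ := Nat.gcd_dvd_right k r
  set D := Nat.gcd k r
  have h1 : (g : F) ^ (2 * b) = 1 := by
    apply (algebraMap F (AlgebraicClosure F)).injective
    rw [pow_mul, map_pow, ← hyk, map_one, ← pow_mul,
      show k * b = r * a by rw [ha, hb]; ring, pow_mul, hy, one_pow]
  have h2 : r ∣ 2 * b := by
    rw [← hord]
    apply orderOf_dvd_of_pow_eq_one
    ext
    simpa using h1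
  have hb0 : 0 < b := Nat.pos_of_ne_zero fun h => by simp [h] at hb; omega
  rw [hb] at h2
  exact hg (Nat.dvd_of_mul_dvd_mul_right hb0 h2)

/-- If `gcd (k, q - 1) ∣ 2` and `2k ≠ 1` in the field, the member of value `1` is squarefree. -/
lemma squarefree_twoValued_of_gcd_dvd_two [Fintype F] {k r : ℕ}
    (hcard : Fintype.card F = r + 1) (hr : (r : F) = -1) (hr0 : 0 < r) (hk : 0 < k)
    (hg : Nat.gcd k r ∣ 2) (h2k : (2 * k : F) ≠ 1) :
    Squarefree (twoValued k r 0 (1 : F)) := by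
  refine squarefree_twoValued_zero hr hr0 hk one_ne_zero fun α hα hk0 hk1 h1 h2 => ?_
  have hcast : algebraMap F (AlgebraicClosure F) (k - 1) = (k : AlgebraicClosure F) - 1 := by simp
  have hk1' : (k : AlgebraicClosure F) - 1 ≠ 0 := by
    rw [← hcast]
    exact (_root_.map_ne_zero _).2 hk1
  have hT : α ^ r = algebraMap F (AlgebraicClosure F) (k / (k - 1)) := by
    rw [map_div₀, hcast, map_natCast, eq_div_iff hk1', mul_comm, h1]
  have hTr : (α ^ r) ^ r = 1 := by
    rw [hT]
    exact algebraMap_pow_eq_one hcard (div_ne_zero hk0 hk1)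
  have hTk : (α ^ r) ^ k = 1 := by
    rw [pow_right_comm, h2, map_one, mul_one, ← hcast, ← map_neg]
    exact algebraMap_pow_eq_one hcard (neg_ne_zero.2 hk1)
  rcases eq_one_or_eq_neg_one_of_gcd_dvd_two hg hTk hTr with h | h
  · rw [h] at h1
    simp at h1
  · rw [h] at h1
    apply h2k
    apply (algebraMap F (AlgebraicClosure F)).injective
    simp only [map_mul, map_ofNat, map_natCast, map_one]
    linear_combination -h1

/-- If `gcd (k, q - 1) ∣ 2` and `2k = 1` in the field, a genuinely two-valued member is
squarefree. -/
lemma squarefree_twoValued_of_two_mul_eq_one [Fintype F] {k r : ℕ}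
    (hcard : Fintype.card F = r + 1) (hr : (r : F) = -1) (hr0 : 0 < r) (hk : 0 < k)
    (hg : Nat.gcd k r ∣ 2) (h2k : (2 * k : F) = 1) {e d : F} (he : e ≠ 0) (hd : d ≠ 0)
    (hne : d ≠ e) (hsum : d + e ≠ 0) :
    Squarefree (twoValued k r e d) := by
  refine squarefree_twoValued hr hr0 hk hd fun α hα h1 h2 => ?_
  set E := algebraMap F (AlgebraicClosure F) e with hE
  set D := algebraMap F (AlgebraicClosure F) d with hD
  have hE0 : E ≠ 0 := (_root_.map_ne_zero _).2 he
  have hDE : D + E ≠ 0 := by rw [hD, hE, ← map_add]; exact (_root_.map_ne_zero _).2 hsum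
  have h2kK : (2 : AlgebraicClosure F) * k = 1 := by
    have := congrArg (algebraMap F (AlgebraicClosure F)) h2k
    simpa only [map_mul, map_ofNat, map_natCast, map_one] using this
  have h20 : (2 : AlgebraicClosure F) ≠ 0 := left_ne_zero_of_mul_eq_one h2kK
  let φ := FiniteField.frobeniusAlgHom F (AlgebraicClosure F)
  have hφ : ∀ x : AlgebraicClosure F, φ x = x ^ r * x := fun x => by
    rw [← pow_succ, ← hcard]; rfl
  set Y := α ^ k with hY
  set T := α ^ r with hT
  have hT0 : T ≠ 0 := pow_ne_zero r hα
  have h3 : Y * (T + 1) = -2 * E * T := by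
    linear_combination -2 * h2 + Y * (T - 1) * h2kK
  have hT1 : T + 1 ≠ 0 := by
    intro h
    rw [h, mul_zero] at h3
    exact mul_ne_zero (mul_ne_zero (neg_ne_zero.2 h20) hE0) hT0 h3.symm
  have hquad : E * T ^ 2 - (3 * E + D) * T - D = 0 := by
    linear_combination (T - 1) * h3 - (T + 1) * h1
  set U := φ T with hU
  have hU0 : U ≠ 0 := (_root_.map_ne_zero _).2 hT0
  have hU1 : U + 1 ≠ 0 := by
    rw [hU, ← map_one φ, ← map_add]
    exact (_root_.map_ne_zero _).2 hT1
  have hφE : φ E = E := φ.commutes e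
  have hφD : φ D = D := φ.commutes d
  have hquadU : E * U ^ 2 - (3 * E + D) * U - D = 0 := by
    have := congrArg φ hquad
    simpa only [map_sub, map_mul, map_add, map_pow, map_ofNat, hφE, hφD, map_zero] using this
  have h3U : φ Y * (U + 1) = -2 * E * U := by
    have := congrArg φ h3
    simpa only [map_mul, map_add, map_neg, map_ofNat, hφE, map_one] using this
  have hTk : T ^ k * Y = φ Y := by
    rw [hφ, hT, hY, pow_right_comm]
  have hTk' : T ^ k * (T * (U + 1)) = U * (T + 1) := by
    apply mul_left_cancel₀ (mul_ne_zero (neg_ne_zero.2 h20) hE0)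
    linear_combination (T + 1) * h3U - T ^ k * (U + 1) * h3 + (U + 1) * (T + 1) * hTk
  by_cases hTU : U = T
  · have hTr : T ^ r = 1 := by
      have := hφ T
      rw [← hU, hTU] at this
      exact mul_right_cancel₀ hT0 (by rw [← this, one_mul])
    have hTk1 : T ^ k = 1 := by
      rw [hTU] at hTk'
      exact mul_right_cancel₀ (mul_ne_zero hT0 hT1) (by rw [hTk', one_mul])
    rcases eq_one_or_eq_neg_one_of_gcd_dvd_two hg hTk1 hTr with h | h
    · rw [h] at hquad
      apply mul_ne_zero h20 hDE
      linear_combination -hquad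
    · exact hT1 (by rw [h]; ring)
  · have hs : E * (U + T) = 3 * E + D := by
      apply mul_left_cancel₀ (sub_ne_zero.2 hTU)
      linear_combination hquadU - hquad
    have hp : E * (T * U) = -D := by
      linear_combination T * hs - hquad
    have hp' : T * U = algebraMap F (AlgebraicClosure F) (-d / e) := by
      rw [map_div₀, map_neg, eq_div_iff hE0]
      linear_combination hp
    have hφU : φ U = T := by
      have := congrArg φ hp
      simp only [map_mul, map_neg, hφE, hφD, ← hU] at this
      apply mul_left_cancel₀ (mul_ne_zero hE0 hU0)
      linear_combination this - hp
    have hUk' : U ^ k * (U * (T + 1)) = T * (U + 1) := by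
      have := congrArg φ hTk'
      simpa only [map_mul, map_pow, map_add, map_one, ← hU, hφU] using this
    have hk1 : (T * U) ^ k = 1 := by
      rw [mul_pow]
      apply mul_right_cancel₀ (mul_ne_zero (mul_ne_zero hT0 hU1) (mul_ne_zero hU0 hT1))
      linear_combination U ^ k * (U * (T + 1)) * hTk' + (U * (T + 1)) * hUk'
    have hr1 : (T * U) ^ r = 1 := by
      rw [hp']
      exact algebraMap_pow_eq_one hcard (div_ne_zero (neg_ne_zero.2 hd) he)
    rcases eq_one_or_eq_neg_one_of_gcd_dvd_two hg hk1 hr1 with h | h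
    · rw [h] at hp
      exact hDE (by linear_combination hp)
    · rw [h] at hp
      apply hne
      apply (algebraMap F (AlgebraicClosure F)).injective
      rw [← hD, ← hE]
      linear_combination hp

/-- Over a field with more than five elements, there is a point off any five prescribed ones. -/
lemma exists_eval_ne_zero_of_five_lt [Fintype F] (hq : 5 < Fintype.card F) {f : F[X]} (hf : f ≠ 0)
    (hdeg : f.natDegree ≤ 5) : ∃ x : F, f.eval x ≠ 0 := by
  apply exists_eval_ne_zero_of_natDegree_lt_card f hf
  rw [Cardinal.mk_fintype]
  exact_mod_cast hdeg.trans_lt hq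

lemma two_ne_zero_of_odd_card [Fintype F] (hodd : Odd (Fintype.card F)) : (2 : F) ≠ 0 := by
  intro h
  obtain ⟨m, hm⟩ := hodd
  have := FiniteField.cast_card_eq_zero F
  rw [hm] at this
  push_cast at this
  rw [h, zero_mul, zero_add] at this
  exact one_ne_zero this

lemma exists_sq_ne [Fintype F] (hodd : Odd (Fintype.card F)) (hq : 5 ≤ Fintype.card F) :
    ∃ z : F, z ≠ 0 ∧ z ^ 2 ≠ 1 ∧ z ^ 2 ≠ 2 := by
  have h2 := two_ne_zero_of_odd_card hodd
  by_cases h3 : (3 : F) = 0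
  · have hq' : 5 < Fintype.card F := by
      refine lt_of_le_of_ne hq fun h => ?_
      have h5 := FiniteField.cast_card_eq_zero F
      rw [← h] at h5
      push_cast at h5
      apply one_ne_zero (α := F)
      linear_combination 2 * h3 - h5
    have hmon : (X * ((X ^ 2 - C 1) * (X ^ 2 - C 2)) : F[X]).Monic :=
      monic_X.mul ((monic_X_pow_sub_C 1 two_ne_zero).mul (monic_X_pow_sub_C 2 two_ne_zero))
    obtain ⟨z, hz⟩ := exists_eval_ne_zero_of_five_lt hq' hmon.ne_zero (by compute_degree)
    simp only [eval_mul, eval_X, eval_sub, eval_pow, eval_C, ne_eq, mul_eq_zero, not_or,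
      sub_eq_zero] at hz
    exact ⟨z, hz.1, hz.2.1, hz.2.2⟩
  · refine ⟨2, h2, fun h => h3 ?_, fun h => h2 ?_⟩
    · linear_combination h
    · linear_combination h

/-- A binomial of degree `q - 1` works when `q > 5`. -/
lemma exists_natDegree_eq_card_sub_one [Fintype F] (hodd : Odd (Fintype.card F)) {r : ℕ}
    (hcard : Fintype.card F = r + 1) (hr : (r : F) = -1) (hr5 : 5 ≤ r) :
    ∃ H : F[X], Squarefree H ∧ H.natDegree = r ∧ (¬ ∃ y : F, H.leadingCoeff = y ^ 2) ∧
      ∀ x : F, ¬ ∃ y : F, H.eval x = y ^ 2 := by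
  have h2 := two_ne_zero_of_odd_card hodd
  have hmon : (X * (X ^ 4 - C 1) : F[X]).Monic :=
    monic_X.mul (monic_X_pow_sub_C 1 (by norm_num))
  obtain ⟨t, ht⟩ := exists_eval_ne_zero_of_five_lt (by omega) hmon.ne_zero (by compute_degree)
  simp only [eval_mul, eval_X, eval_sub, eval_pow, eval_C, ne_eq, mul_eq_zero, not_or] at ht
  obtain ⟨ht0, ht4⟩ := ht
  have ha : 2 * t ≠ 0 := mul_ne_zero h2 ht0
  have hb : 1 - t ^ 2 ≠ 0 := fun h => ht4 (by linear_combination (-1 - t ^ 2) * h)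
  have hc : 1 + t ^ 2 ≠ 0 := fun h => ht4 (by linear_combination (t ^ 2 - 1) * h)
  have hdeg : (C ((2 * t) ^ 2) * X ^ r + C ((1 - t ^ 2) ^ 2) : F[X]).natDegree = r := by
    rw [natDegree_add_C, natDegree_C_mul_X_pow r _ (pow_ne_zero 2 ha)]
  refine exists_nonsquare_valued_of_square_valued hodd
    (N := C ((2 * t) ^ 2) * X ^ r + C ((1 - t ^ 2) ^ 2)) ?_ hdeg ⟨2 * t, ha, ?_⟩ fun x => ?_
  · refine squarefree_of_no_common_root _ fun α h0 h1 => ?_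
    have hrK : (r : AlgebraicClosure F) ≠ 0 := by
      rw [← map_natCast (algebraMap F (AlgebraicClosure F)), hr]
      exact (_root_.map_ne_zero _).2 (neg_ne_zero.2 one_ne_zero)
    have haK := (_root_.map_ne_zero (algebraMap F (AlgebraicClosure F))).2 (pow_ne_zero 2 ha)
    have hα : α = 0 := by
      rw [derivative_add, derivative_C, add_zero, derivative_C_mul, derivative_X_pow, map_mul,
        map_mul, aeval_C, aeval_C, map_pow (aeval α), aeval_X, map_natCast] at h1
      exact eq_zero_of_pow_eq_zero
        ((mul_eq_zero.1 ((mul_eq_zero.1 h1).resolve_left haK)).resolve_left hrK)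
    rw [hα, map_add, map_mul, aeval_C, aeval_C, map_pow (aeval 0) X, aeval_X,
      zero_pow (by omega), mul_zero, zero_add] at h0
    exact (_root_.map_ne_zero _).2 (pow_ne_zero 2 hb) h0
  · rw [leadingCoeff, hdeg]
    rw [coeff_add, coeff_C_mul_X_pow, coeff_C, if_pos rfl, if_neg (by omega), add_zero]
  · by_cases hx : x = 0
    · refine ⟨1 - t ^ 2, hb, ?_⟩
      simp [hx, show r ≠ 0 by omega]
    · refine ⟨1 + t ^ 2, hc, ?_⟩
      have := FiniteField.pow_card_sub_one_eq_one x hx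
      rw [hcard, Nat.add_sub_cancel] at this
      simp only [eval_add, eval_mul, eval_C, eval_pow, eval_X, this]
      ring

/-- Over the field with three elements, `X ^ n - X ^ 4 + 1` works when `n` is even and
`n ≡ 1 mod 3`. -/
lemma exists_of_card_eq_three [Fintype F] (hcard : Fintype.card F = 3) {g : ℕ} (hg : 2 ≤ g)
    (hn : ((2 * g + 2 : ℕ) : F) = 1) :
    ∃ H : F[X], Squarefree H ∧ H.natDegree = 2 * g + 2 ∧
      (¬ ∃ y : F, H.leadingCoeff = y ^ 2) ∧ ∀ x : F, ¬ ∃ y : F, H.eval x = y ^ 2 := by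
  have h3 : (3 : F) = 0 := by
    have := FiniteField.cast_card_eq_zero F
    rw [hcard] at this
    exact_mod_cast this
  obtain ⟨j, rfl⟩ : ∃ j, g = j + 2 := ⟨g - 2, by omega⟩
  have heq : (X ^ (2 * (j + 2) + 2) - X ^ 4 + 1 : F[X]) =
      X ^ (2 * (j + 2) + 2) + (C 1 - X ^ 4) := by
    rw [C_1]
    ring
  have haux : (C 1 - X ^ 4 : F[X]).degree < (2 * (j + 2) + 2 : ℕ) := by
    have : (C 1 - X ^ 4 : F[X]).degree ≤ (4 : ℕ) := by
      compute_degree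
      rfl
    exact this.trans_lt (by exact_mod_cast (by omega : 4 < 2 * (j + 2) + 2))
  have hmon : (X ^ (2 * (j + 2) + 2) - X ^ 4 + 1 : F[X]).Monic := by
    rw [heq]
    exact monic_X_pow_add haux
  refine exists_nonsquare_valued_of_square_valued (by rw [hcard]; decide)
    (N := X ^ (2 * (j + 2) + 2) - X ^ 4 + 1) ?_ ?_ ⟨1, one_ne_zero, by rw [hmon, one_pow]⟩
    fun x => ⟨1, one_ne_zero, ?_⟩
  · refine squarefree_of_no_common_root _ fun α h0 h1 => ?_
    have hnK : ((2 * (j + 2) + 2 : ℕ) : AlgebraicClosure F) = 1 := by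
      rw [← map_natCast (algebraMap F (AlgebraicClosure F)), hn, map_one]
    have h3K : (3 : AlgebraicClosure F) = 0 := by
      rw [← map_ofNat (algebraMap F (AlgebraicClosure F)), h3, map_zero]
    simp only [derivative_X_pow, derivative_one, map_add, map_sub,
      map_mul, map_pow, aeval_X, map_natCast, map_one, map_zero] at h0 h1
    rw [hnK, show 2 * (j + 2) + 2 - 1 = 2 * j + 5 by omega] at h1
    push_cast at h1
    apply one_ne_zero (α := AlgebraicClosure F)
    linear_combination h0 - α * h1 - α ^ 4 * h3K
  · apply natDegree_eq_of_degree_eq_some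
    rw [heq, degree_add_eq_left_of_degree_lt, degree_X_pow]
    rwa [degree_X_pow]
  · by_cases hx : x = 0
    · simp [hx]
    · have hx2 : x ^ 2 = 1 := by
        have := FiniteField.pow_card_sub_one_eq_one x hx
        rwa [hcard] at this
      have hx4 : x ^ 4 = 1 := by rw [show 4 = 2 * 2 from rfl, pow_mul, hx2, one_pow]
      have hxn : x ^ (2 * (j + 2) + 2) = 1 := by
        rw [show 2 * (j + 2) + 2 = 2 * (j + 3) by ring, pow_mul, hx2, one_pow]
      simp [hxn, hx4]

end PointlessHyperelliptic

open PointlessHyperelliptic in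
/-- For an odd prime power `q` and `g ≥ max{(q−3)/2, 2}`, there is a squarefree
polynomial `H ∈ F_q[X]` of degree `2g+2` with non-square leading coefficient whose values on
`F_q` are all non-squares. -/
theorem stmt_0 (F : Type*) [Field F] [Fintype F]
    (hodd : Odd (Fintype.card F))
    (g : ℕ) (hg : g ≥ max ((Fintype.card F - 3) / 2) 2) :
    ∃ H : Polynomial F,
      Squarefree H ∧
      H.natDegree = 2 * g + 2 ∧
      (¬ ∃ y : F, H.leadingCoeff = y ^ 2) ∧
      ∀ x : F, ¬ ∃ y : F, H.eval x = y ^ 2 := by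
  obtain ⟨hg1, hg2⟩ := max_le_iff.1 hg
  obtain ⟨r, hcard⟩ : ∃ r, Fintype.card F = r + 1 :=
    ⟨Fintype.card F - 1, by have := Fintype.card_pos (α := F); omega⟩
  have hr0 : 0 < r := by have := Fintype.one_lt_card (α := F); omega
  have hr : (r : F) = -1 := by
    have := FiniteField.cast_card_eq_zero F
    rw [hcard] at this
    push_cast at this
    linear_combination this
  have hrev : r % 2 = 0 := by
    rw [hcard, Nat.odd_iff] at hodd
    omega
  obtain ⟨k, hk⟩ : ∃ k, 2 * g + 2 = k + r := ⟨2 * g + 2 - r, by omega⟩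
  rcases Nat.eq_zero_or_pos k with rfl | hk0
  · rw [hk, zero_add]
    exact exists_natDegree_eq_card_sub_one hodd hcard hr (by omega)
  by_cases hgcd : Nat.gcd k r ∣ 2
  swap
  · obtain ⟨s, hs, hsq⟩ := exists_squarefree_of_not_gcd_dvd_two hcard hr hr0 hk0 hgcd
    rw [hk]
    exact exists_of_squarefree_twoValued hodd hcard hr0 hk0 hs hs rfl (add_zero _) hsq
  by_cases h2k : (2 * k : F) = 1
  swap
  · rw [hk]
    exact exists_of_squarefree_twoValued hodd hcard hr0 hk0 one_ne_zero one_ne_zero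
      (one_pow 2).symm (by rw [add_zero, one_pow])
      (squarefree_twoValued_of_gcd_dvd_two hcard hr hr0 hk0 hgcd h2k)
  by_cases hq : 5 ≤ Fintype.card F
  · obtain ⟨z, hz0, hz1, hz2⟩ := exists_sq_ne hodd hq
    rw [hk]
    refine exists_of_squarefree_twoValued (e := z ^ 2 - 1) (d := 1) hodd hcard hr0 hk0
      one_ne_zero hz0 (one_pow 2).symm (by ring)
      (squarefree_twoValued_of_two_mul_eq_one hcard hr hr0 hk0 hgcd h2k (sub_ne_zero.2 hz1)
        one_ne_zero (fun h => hz2 (by linear_combination -h)) ?_)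
    rw [add_sub_cancel]
    exact pow_ne_zero 2 hz0
  · obtain rfl : r = 2 := by omega
    refine exists_of_card_eq_three hcard hg2 ?_
    rw [hk]
    push_cast at hr ⊢
    linear_combination -h2k + (k : F) * hr
end

section
/- Let p be an odd prime and let g be an integer with g ≥ max{(p−1)/2, 2}. Then there exists a monic squarefree polynomial F ∈ F_p[X] of degree 2g+2 such that F(x) is a nonzero square in F_p for every x ∈ F_p; moreover F can be taken either of the form X^{2g+2} − X^{2g+2−l(p−1)} + a² for some nonzero a ∈ F_p and some integer l with 1 ≤ l ≤ ⌊(2g+2)/(p−1)⌋, or equal to X^{p+(p−1)/2} + X^{p−1} + X^{(p−3)/2} + 1. (Consequently there is a smooth F_p-maximal hyperelliptic curve of genus g over F_p, and hence a smooth pointless hyperelliptic curve of genus g over F_p.) -/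
open Polynomial

section Aux

variable {p : ℕ} [Fact p.Prime]

/-- A polynomial over `ZMod p` is squarefree if it has no common root with its derivative in an
algebraic closure. -/
lemma squarefree_of_forall_aeval {F : (ZMod p)[X]}
    (h : ∀ β : AlgebraicClosure (ZMod p), aeval β F = 0 → aeval β (derivative F) ≠ 0) :
    Squarefree F := by
  apply Separable.squarefree
  unfold Separable
  rw [isCoprime_iff_aeval_ne_zero_of_isAlgClosed (ZMod p) (AlgebraicClosure (ZMod p))]
  intro β
  by_cases hβ : aeval β F = 0
  · exact Or.inr (h β hβ)
  · exact Or.inl hβ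

lemma cast_sub_one_eq_neg_one (K : Type*) [Ring K] [CharP K p] : ((p - 1 : ℕ) : K) = -1 := by
  rw [Nat.cast_sub (Fact.out : p.Prime).one_le, CharP.cast_eq_zero]
  simp

/-- Fermat's little theorem for the prime field of `K`. -/
lemma algebraMap_pow_sub_one_eq_one (K : Type*) [Field K] [Algebra (ZMod p) K] {a : ZMod p}
    (ha : a ≠ 0) : (algebraMap (ZMod p) K a) ^ (p - 1) = 1 := by
  rw [← map_pow, ZMod.pow_card_sub_one_eq_one ha, map_one]

lemma natCast_pow_sub_one_eq_one {K : Type*} [Field K] [Algebra (ZMod p) K] {m : ℕ}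
    (hm : (m : K) ≠ 0) : (m : K) ^ (p - 1) = 1 := by
  have h : (m : ZMod p) ≠ 0 := fun h => hm (by
    rw [← map_natCast (algebraMap (ZMod p) K), h, map_zero])
  simpa using algebraMap_pow_sub_one_eq_one K h

lemma monic_X_pow_sub_X_pow_add_C {k n : ℕ} (hkn : k < n) (c : ZMod p) :
    (X ^ n - X ^ k + C c : (ZMod p)[X]).Monic ∧
      (X ^ n - X ^ k + C c : (ZMod p)[X]).natDegree = n := by
  have hd : (-X ^ k + C c : (ZMod p)[X]).degree < n := by
    refine (degree_add_le _ _).trans_lt (max_lt ?_ (degree_C_le.trans_lt ?_))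
    · rw [degree_neg, degree_X_pow]
      exact_mod_cast hkn
    · exact_mod_cast (Nat.zero_le k).trans_lt hkn
  have e : (X ^ n - X ^ k + C c : (ZMod p)[X]) = X ^ n + (-X ^ k + C c) := by ring
  rw [e]
  refine ⟨monic_X_pow_add hd, ?_⟩
  rw [natDegree_eq_of_degree_eq_some]
  rw [degree_add_eq_left_of_degree_lt (by rwa [degree_X_pow]), degree_X_pow]

lemma eval_X_pow_sub_X_pow_add_C {k l : ℕ} (hk : 0 < k) (c x : ZMod p) :
    (X ^ (k + l * (p - 1)) - X ^ k + C c : (ZMod p)[X]).eval x = c := by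
  rcases eq_or_ne x 0 with rfl | hx
  · simp [hk.ne']
  · simp [pow_add, mul_comm l, pow_mul, ZMod.pow_card_sub_one_eq_one hx]

lemma squarefree_X_pow_sub_X_pow_add_C {k l : ℕ} (hk : 0 < k) {c : ZMod p} (hc : c ≠ 0)
    (h : ∀ β : AlgebraicClosure (ZMod p), β ≠ 0 →
      ((k + l * (p - 1) : ℕ) : AlgebraicClosure (ZMod p)) * (β ^ (p - 1)) ^ l = k →
      β ^ k * ((β ^ (p - 1)) ^ l - 1) + algebraMap _ _ c ≠ 0) :
    Squarefree (X ^ (k + l * (p - 1)) - X ^ k + C c : (ZMod p)[X]) := by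
  apply squarefree_of_forall_aeval
  intro β hF hF'
  have hβ : β ≠ 0 := by
    rintro rfl
    simp [hk.ne', hc] at hF
  obtain ⟨k, rfl⟩ := Nat.exists_eq_add_of_lt hk
  simp only [zero_add] at *
  refine h β hβ ?_ ?_
  · have e : k + 1 + l * (p - 1) - 1 = k + l * (p - 1) := by omega
    simp only [derivative_add, derivative_sub, derivative_X_pow, derivative_C, e] at hF'
    simp only [map_sub, map_mul, map_natCast, map_pow, aeval_X, add_zero,
      Nat.add_sub_cancel, pow_add] at hF'
    apply mul_left_cancel₀ (pow_ne_zero k hβ)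
    rw [← pow_mul, mul_comm (p - 1)]
    linear_combination hF'
  · simp only [map_add, map_sub, map_pow, aeval_X, aeval_C] at hF
    rw [← pow_mul, mul_comm (p - 1), ← hF, pow_add _ (k + 1)]
    ring

/-- If every `X ^ n - X ^ k + a ^ 2` with `n = k + (p - 1)` fails to be squarefree, then `n` is
`-1 / 2` modulo `p` and `gcd (k, p - 1) = 2`. -/
lemma gcd_eq_two_of_forall_not_squarefree (hp2 : p ≠ 2) {k : ℕ} (hk : 0 < k) (hk2 : Even k)
    (h : ∀ a : ZMod p, a ≠ 0 →
      ¬ Squarefree (X ^ (k + 1 * (p - 1)) - X ^ k + C (a ^ 2) : (ZMod p)[X])) :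
    k.gcd (p - 1) = 2 ∧ p ∣ 2 * (k + (p - 1)) + 1 := by
  set K := AlgebraicClosure (ZMod p)
  have hp : p.Prime := Fact.out
  have : CharP K p := charP_of_injective_algebraMap (algebraMap (ZMod p) K).injective p
  have hq : ((p - 1 : ℕ) : K) = -1 := cast_sub_one_eq_neg_one K
  have key : ∀ a : ZMod p, a ≠ 0 → ∃ β : K, β ≠ 0 ∧
      ((k : K) - 1) * β ^ (p - 1) = k ∧ β ^ k = - ((k : K) - 1) * (algebraMap _ K a) ^ 2 := by
    intro a ha
    by_contra! hcon
    refine h a ha (squarefree_X_pow_sub_X_pow_add_C hk (pow_ne_zero 2 ha) ?_)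
    intro β hβ h1 h2
    rw [one_mul, Nat.cast_add, hq, ← sub_eq_add_neg, pow_one] at h1
    refine hcon β hβ h1 ?_
    rw [map_pow, pow_one] at h2
    linear_combination ((k : K) - 1) * h2 - β ^ k * h1
  have hN : ((k : K) - 1) = ((k + (p - 1) : ℕ) : K) := by
    rw [Nat.cast_add, hq]
    ring
  obtain ⟨β, hβ, hβ1, hβ2⟩ := key 1 one_ne_zero
  rw [map_one, one_pow, mul_one] at hβ2
  have hn0 : (k : K) - 1 ≠ 0 := by
    intro h0
    rw [h0, neg_zero] at hβ2
    exact pow_ne_zero k hβ hβ2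
  have hk0 : (k : K) ≠ 0 := by
    intro h0
    rw [h0] at hβ1
    exact mul_ne_zero (by simp) (pow_ne_zero _ hβ) hβ1
  have hn1 : ((k : K) - 1) ^ (p - 1) = 1 := by
    rw [hN] at hn0 ⊢
    exact natCast_pow_sub_one_eq_one hn0
  have hev : Even (p - 1) := hp.even_sub_one hp2
  have hgcd : k.gcd (p - 1) = 2 := by
    obtain ⟨g, hg⟩ := IsCyclic.exists_generator (α := (ZMod p)ˣ)
    have hord := orderOf_eq_card_of_forall_mem_zpowers hg
    rw [Nat.card_eq_fintype_card, ZMod.card_units] at hord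
    obtain ⟨γ, hγ, hγ1, hγ2⟩ := key g g.ne_zero
    have hγβ : γ ^ (p - 1) = β ^ (p - 1) := mul_left_cancel₀ hn0 (hγ1.trans hβ1.symm)
    have hγβ2 : γ ^ k = β ^ k * (algebraMap _ K (g : ZMod p)) ^ 2 := by rw [hγ2, hβ2]
    obtain ⟨k', hk'⟩ := Nat.gcd_dvd_left k (p - 1)
    obtain ⟨e, he⟩ := Nat.gcd_dvd_right k (p - 1)
    have hp1 : 0 < p - 1 := by have := hp.two_le; omega
    have hdpos : 0 < k.gcd (p - 1) := Nat.gcd_pos_of_pos_left _ hk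
    have hkeep : k * e = (p - 1) * k' := by
      conv_lhs => rw [hk']
      conv_rhs => rw [he]
      ring
    have hge : (algebraMap _ K (g : ZMod p)) ^ (2 * e) = 1 := by
      have h3 : γ ^ (k * e) = β ^ (k * e) := by rw [hkeep, pow_mul, hγβ, ← pow_mul]
      rw [pow_mul γ, hγβ2, mul_pow, ← pow_mul, ← pow_mul] at h3
      exact mul_left_cancel₀ (pow_ne_zero (k * e) hβ) (by rw [h3, mul_one])
    have hge' : g ^ (2 * e) = 1 := by
      apply Units.ext
      apply (algebraMap (ZMod p) K).injective
      rw [Units.val_pow_eq_pow_val, map_pow, hge, Units.val_one, map_one]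
    have hdvd := orderOf_dvd_of_pow_eq_one hge'
    rw [hord] at hdvd
    have hepos : 0 < e := Nat.pos_of_ne_zero (by rintro rfl; omega)
    have hd2 : k.gcd (p - 1) ∣ 2 := by
      apply Nat.dvd_of_mul_dvd_mul_right hepos
      rwa [← he]
    exact Nat.dvd_antisymm hd2 (Nat.dvd_gcd hk2.two_dvd hev.two_dvd)
  refine ⟨hgcd, ?_⟩
  have hb1 : (β ^ (p - 1)) ^ (p - 1) = 1 := by
    have h3 := congrArg (· ^ (p - 1)) hβ1
    simp only [mul_pow, hn1, one_mul] at h3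
    rw [h3]
    exact natCast_pow_sub_one_eq_one hk0
  have hb2 : (β ^ (p - 1)) ^ k = 1 := by
    rw [← pow_mul, mul_comm, pow_mul, hβ2, hev.neg_pow, hn1]
  have hb3 : (β ^ (p - 1)) ^ 2 = 1 := by
    rw [← hgcd]
    exact pow_gcd_eq_one.2 ⟨hb2, hb1⟩
  have hb4 : β ^ (p - 1) = -1 := by
    rcases eq_or_eq_neg_of_sq_eq_sq _ _ (hb3.trans (one_pow 2).symm) with h | h
    · rw [h] at hβ1
      exact absurd (show (1 : K) = 0 by linear_combination -hβ1) one_ne_zero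
    · exact h
  rw [← CharP.cast_eq_zero_iff K p, Nat.cast_add, Nat.cast_mul, ← hN]
  rw [hb4] at hβ1
  push_cast
  linear_combination -hβ1

lemma squarefree_of_dvd_of_gcd_eq_two (hp2 : p ≠ 2) {k : ℕ} (hk : 0 < k)
    (hgcd : k.gcd (p - 1) = 2) (hdvd : p ∣ 2 * (k + 2 * (p - 1)) + 1) :
    Squarefree (X ^ (k + 2 * (p - 1)) - X ^ k + C (1 ^ 2) : (ZMod p)[X]) := by
  set K := AlgebraicClosure (ZMod p)
  have hp : p.Prime := Fact.out
  have : CharP K p := charP_of_injective_algebraMap (algebraMap (ZMod p) K).injective p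
  have hq : ((p - 1 : ℕ) : K) = -1 := cast_sub_one_eq_neg_one K
  have h2 : (2 : K) ≠ 0 := by
    intro h
    have h' : ((2 : ℕ) : K) = 0 := by exact_mod_cast h
    rw [CharP.cast_eq_zero_iff K p] at h'
    exact hp2 ((Nat.prime_dvd_prime_iff_eq hp Nat.prime_two).1 h')
  refine squarefree_X_pow_sub_X_pow_add_C hk (by simp) ?_
  intro β hβ h3 h4
  rw [← CharP.cast_eq_zero_iff K p, Nat.cast_add, Nat.cast_mul, Nat.cast_add, Nat.cast_mul, hq]
    at hdvd
  push_cast at hdvd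
  push_cast [hq] at h3
  rw [one_pow, map_one] at h4
  have ht : (β ^ (p - 1)) ^ 2 = -3 := by
    linear_combination -2 * h3 + ((β ^ (p - 1)) ^ 2 - 1) * hdvd
  have h3ne : ((3 : ℕ) : K) ≠ 0 := by
    intro h
    refine pow_ne_zero 2 (pow_ne_zero (p - 1) hβ) ?_
    rw [ht]
    push_cast at h
    rw [h, neg_zero]
  have h4ne : ((4 : ℕ) : K) ≠ 0 := by
    push_cast
    rw [show (4 : K) = 2 * 2 by norm_num]
    exact mul_ne_zero h2 h2
  have hev : Even (p - 1) := hp.even_sub_one hp2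
  have hβk : (β ^ (p - 1)) ^ k = 1 := by
    have h5 : β ^ k * ((4 : ℕ) : K) = 1 := by
      rw [ht] at h4
      push_cast
      linear_combination -h4
    have h6 := congrArg (· ^ (p - 1)) h5
    simp only [mul_pow, natCast_pow_sub_one_eq_one h4ne, mul_one, one_pow] at h6
    rw [← pow_mul, mul_comm, pow_mul, h6]
  have hv1 : ((β ^ (p - 1)) ^ 2) ^ k = 1 := by
    rw [← pow_mul, mul_comm, pow_mul, hβk, one_pow]
  have hv2 : ((β ^ (p - 1)) ^ 2) ^ (p - 1) = 1 := by
    rw [ht, hev.neg_pow]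
    simpa using natCast_pow_sub_one_eq_one h3ne
  have hv3 := pow_gcd_eq_one.2 ⟨hv1, hv2⟩
  rw [hgcd, ht] at hv3
  exact pow_ne_zero 3 h2 (by linear_combination hv3)

/-- The exceptional polynomial of degree `(3 * p - 1) / 2`, where `p = 2 * h + 1`. -/
lemma squarefree_exceptional {h : ℕ} (hh : 2 ≤ h) (hp : p = 2 * h + 1) :
    Squarefree (X ^ (3 * h + 1) + X ^ (2 * h) + X ^ (h - 1) + 1 : (ZMod p)[X]) := by
  set K := AlgebraicClosure (ZMod p)
  have : CharP K p := charP_of_injective_algebraMap (algebraMap (ZMod p) K).injective p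
  have hpp : p.Prime := Fact.out
  have hhK : (2 : K) * h + 1 = 0 := by
    have h0 : ((2 * h + 1 : ℕ) : K) = 0 := by rw [← hp]; exact CharP.cast_eq_zero K p
    rwa [Nat.cast_add, Nat.cast_mul, Nat.cast_two, Nat.cast_one] at h0
  have h2 : (2 : K) ≠ 0 := by
    intro h
    rw [h, zero_mul, zero_add] at hhK
    exact one_ne_zero hhK
  obtain ⟨m, rfl⟩ := Nat.exists_eq_add_of_le hh
  apply squarefree_of_forall_aeval
  intro β hF hF'
  have hm1 : 2 + m - 1 = m + 1 := by omega
  have e : 2 * (2 + m) - 1 = 2 * m + 3 := by omega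
  rw [hm1] at hF hF'
  have hβ : β ≠ 0 := by
    rintro rfl
    simp at hF
  simp only [derivative_add, derivative_X_pow, derivative_one, e, Nat.add_sub_cancel] at hF'
  simp only [map_add, map_mul, map_natCast, map_pow, aeval_X, add_zero, map_one] at hF hF'
  push_cast at hF' hhK
  set s := β ^ (2 + m) with hs
  have hs0 : s ≠ 0 := pow_ne_zero _ hβ
  -- clear denominators in the two vanishing conditions
  have A : s ^ 3 * β ^ 2 + s ^ 2 * β + s + β = 0 := by
    rw [hs]
    linear_combination β * hF
  have B : s ^ 2 * β ^ 2 + 2 * s * β + 3 = 0 := by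
    apply mul_left_cancel₀ hs0
    rw [hs]
    linear_combination (-2 * β ^ 2) * hF' +
      (3 * β ^ (3 * (2 + m) + 2) + 2 * β ^ (2 * m + 5) + β ^ (m + 2)) * hhK
  have D : s ^ 2 * β + 2 * s - β = 0 := by linear_combination s * B - A
  have hβ2 : β ^ 2 = -3 := by linear_combination B - β * D
  have hs4 : s ^ 4 = 1 := by
    have h3ne : ((3 : ℕ) : K) ≠ 0 := by
      intro h
      push_cast at h
      exact pow_ne_zero 2 hβ (by rw [hβ2, h, neg_zero])
    have h3 := natCast_pow_sub_one_eq_one (p := p) h3ne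
    have hev : Even (p - 1) := ⟨2 + m, by omega⟩
    rw [← hev.neg_pow] at h3
    push_cast at h3
    rw [← hβ2, ← pow_mul] at h3
    rw [hs, ← pow_mul, ← h3]
    congr 1
    omega
  have hs2 : (s ^ 2 - 1) * (s ^ 2 + 1) = 0 := by linear_combination hs4
  rcases mul_eq_zero.1 hs2 with h1 | h1
  · exact mul_ne_zero h2 hs0 (by linear_combination D - β * h1)
  · have hsβ : s = β := mul_left_cancel₀ h2 (by linear_combination D - β * h1)
    rw [hsβ] at h1
    exact h2 (by linear_combination hβ2 - h1)

lemma eval_exceptional {h : ℕ} (hh : 2 ≤ h) (hodd : Odd h) (hp : p = 2 * h + 1) (x : ZMod p) :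
    ∃ y : ZMod p, y ≠ 0 ∧
      (X ^ (3 * h + 1) + X ^ (2 * h) + X ^ (h - 1) + 1 : (ZMod p)[X]).eval x = y ^ 2 := by
  have h2 : (2 : ZMod p) ≠ 0 := by
    intro h0
    have : ((2 * h + 1 : ℕ) : ZMod p) = 0 := by rw [← hp]; exact CharP.cast_eq_zero _ p
    push_cast at this
    rw [h0, zero_mul, zero_add] at this
    exact one_ne_zero this
  simp only [eval_add, eval_pow, eval_X, eval_one]
  rcases eq_or_ne x 0 with rfl | hx
  · refine ⟨1, one_ne_zero, ?_⟩
    simp [show h ≠ 0 by omega, show h - 1 ≠ 0 by omega]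
  have hp2 : p / 2 = h := by omega
  have hs := ZMod.pow_div_two_eq_neg_one_or_one p hx
  have hx1 : x ^ h = x ^ (h - 1) * x := by rw [← pow_succ]; congr 1; omega
  rw [hp2] at hs
  have hs0 : x ^ h ≠ 0 := pow_ne_zero _ hx
  obtain ⟨z, hz⟩ : IsSquare (x * x ^ h) := by
    rw [ZMod.euler_criterion p (mul_ne_zero hx hs0), hp2, mul_pow]
    rcases hs with hs | hs <;> simp [hs, hodd.neg_one_pow]
  have hne : x + x ^ h ≠ 0 := by
    intro h0
    rcases hs with hs | hs
    · rw [hs] at h0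
      rw [eq_neg_of_add_eq_zero_left h0, hodd.neg_one_pow] at hs
      exact h2 (by linear_combination -hs)
    · rw [hs, add_neg_eq_zero] at h0
      rw [h0, one_pow] at hs
      exact h2 (by linear_combination hs)
  have hz0 : z ≠ 0 := by
    rintro rfl
    exact mul_ne_zero hx hs0 (by rw [hz, mul_zero])
  have hs1 : (x ^ h) ^ 2 = 1 := by
    rcases hs with hs | hs <;> simp [hs]
  refine ⟨z * (x + x ^ h) / x, div_ne_zero (mul_ne_zero hz0 hne) hx, ?_⟩
  rw [div_pow, eq_div_iff (pow_ne_zero 2 hx), mul_pow, pow_two z, ← hz, pow_succ x (3 * h),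
    mul_comm 3 h, mul_comm 2 h, pow_mul, pow_mul]
  linear_combination (-x) * hx1 + (x ^ h * x ^ 3 - x ^ 2 - x * x ^ h) * hs1

end Aux

/-- For `p` an odd prime and `g ≥ max{(p−1)/2, 2}` there is a monic squarefree
polynomial `F ∈ F_p[X]` of degree `2g+2` whose values on `F_p` are nonzero squares, of one of
the two indicated forms. -/
theorem stmt_9 (p : ℕ) (hp : p.Prime) (hodd : Odd p)
    (g : ℕ) (hg : g ≥ max ((p - 1) / 2) 2) :
    ∃ F : Polynomial (ZMod p), F.Monic ∧ Squarefree F ∧ F.natDegree = 2 * g + 2 ∧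
      (∀ x : ZMod p, ∃ y : ZMod p, y ≠ 0 ∧ F.eval x = y ^ 2) ∧
      ((∃ a : ZMod p, a ≠ 0 ∧ ∃ l : ℕ, 1 ≤ l ∧ l ≤ (2 * g + 2) / (p - 1) ∧
          F = X ^ (2 * g + 2) - X ^ (2 * g + 2 - l * (p - 1)) + C (a ^ 2)) ∨
        F = X ^ (p + (p - 1) / 2) + X ^ (p - 1) + X ^ ((p - 3) / 2) + 1) := by
  have : Fact p.Prime := ⟨hp⟩
  obtain ⟨h, rfl⟩ := hodd
  have hp2 : 2 * h + 1 ≠ 2 := by omega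
  have hp0 := hp.two_le
  have hg1 : h ≤ g := by have := le_of_max_le_left hg; omega
  have hg2 : 2 ≤ g := le_of_max_le_right hg
  have main : ∀ k l : ℕ, 0 < k → 1 ≤ l → k + l * (2 * h + 1 - 1) = 2 * g + 2 →
      ∀ a : ZMod (2 * h + 1), a ≠ 0 →
      Squarefree (X ^ (k + l * (2 * h + 1 - 1)) - X ^ k + C (a ^ 2) : (ZMod (2 * h + 1))[X]) →
      ∃ F : Polynomial (ZMod (2 * h + 1)), F.Monic ∧ Squarefree F ∧ F.natDegree = 2 * g + 2 ∧
      (∀ x : ZMod (2 * h + 1), ∃ y : ZMod (2 * h + 1), y ≠ 0 ∧ F.eval x = y ^ 2) ∧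
      (∃ a : ZMod (2 * h + 1), a ≠ 0 ∧ ∃ l : ℕ, 1 ≤ l ∧ l ≤ (2 * g + 2) / (2 * h + 1 - 1) ∧
          F = X ^ (2 * g + 2) - X ^ (2 * g + 2 - l * (2 * h + 1 - 1)) + C (a ^ 2)) := by
    intro k l hk hl hkl a ha hsq
    have hpos : 0 < l * (2 * h + 1 - 1) := Nat.mul_pos hl (by omega)
    obtain ⟨hm, hd⟩ := monic_X_pow_sub_X_pow_add_C (Nat.lt_add_of_pos_right (n := k) hpos) (a ^ 2)
    refine ⟨_, hm, hsq, hd.trans hkl, fun x => ⟨a, ha, eval_X_pow_sub_X_pow_add_C hk _ x⟩,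
      a, ha, l, hl, ?_, ?_⟩
    · rw [Nat.le_div_iff_mul_le (by omega)]
      omega
    · rw [← hkl, Nat.add_sub_cancel (n := k) (m := l * (2 * h + 1 - 1))]
  suffices H : (∃ k l : ℕ, 0 < k ∧ 1 ≤ l ∧ k + l * (2 * h + 1 - 1) = 2 * g + 2 ∧
      ∃ a : ZMod (2 * h + 1), a ≠ 0 ∧
      Squarefree (X ^ (k + l * (2 * h + 1 - 1)) - X ^ k + C (a ^ 2) : (ZMod (2 * h + 1))[X])) ∨
      (2 ≤ h ∧ Odd h ∧ 2 * g + 2 = 3 * h + 1) by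
    rcases H with ⟨k, l, hk, hl, hkl, a, ha, hsq⟩ | ⟨hh, hho, hgh⟩
    · obtain ⟨F, h1, h2, h3, h4, h5⟩ := main k l hk hl hkl a ha hsq
      exact ⟨F, h1, h2, h3, h4, Or.inl h5⟩
    · have e : (X ^ (3 * h + 1) + X ^ (2 * h) + X ^ (h - 1) + 1 : (ZMod (2 * h + 1))[X]) =
          X ^ (3 * h + 1) + (X ^ (2 * h) + X ^ (h - 1) + 1) := by ring
      have hd : (X ^ (2 * h) + X ^ (h - 1) + 1 : (ZMod (2 * h + 1))[X]).degree <
          (3 * h + 1 : ℕ) := by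
        refine (degree_add_le _ _).trans_lt (max_lt ((degree_add_le _ _).trans_lt
          (max_lt ?_ ?_)) ?_)
        · rw [degree_X_pow]; exact_mod_cast (by omega)
        · rw [degree_X_pow]; exact_mod_cast (by omega)
        · rw [degree_one]; exact_mod_cast (by omega)
      refine ⟨_, ?_, squarefree_exceptional hh rfl, ?_, eval_exceptional hh hho rfl, Or.inr ?_⟩
      · rw [e]
        exact monic_X_pow_add hd
      · rw [e, hgh]
        apply natDegree_eq_of_degree_eq_some
        rw [degree_add_eq_left_of_degree_lt (by rwa [degree_X_pow]), degree_X_pow]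
      · congr 4 <;> omega
  by_contra! hcon
  obtain ⟨hc1, hc2⟩ := hcon
  set k := 2 * g + 2 - (2 * h + 1 - 1)
  have hk0 : 0 < k := by omega
  obtain ⟨hgcd, hdvd⟩ := gcd_eq_two_of_forall_not_squarefree hp2 hk0 ⟨g + 1 - h, by omega⟩
    (hc1 k 1 hk0 le_rfl (by omega))
  by_cases hlt : 2 * (2 * h + 1 - 1) < 2 * g + 2
  · set k' := 2 * g + 2 - 2 * (2 * h + 1 - 1)
    have hkk : k = k' + (2 * h + 1 - 1) := by omega
    rw [hkk, Nat.gcd_add_self_left] at hgcd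
    exact hc1 k' 2 (by omega) (by omega) (by omega) 1 one_ne_zero
      (squarefree_of_dvd_of_gcd_eq_two hp2 (by omega) hgcd (by convert hdvd using 3; omega))
  · obtain ⟨c, hc⟩ := hdvd
    have hc3 : c = 3 := by
      have h1 : 2 < c := by
        by_contra! hle
        have := Nat.mul_le_mul_left (2 * h + 1) hle
        omega
      have h2 : c < 4 := by
        by_contra! hle
        have := Nat.mul_le_mul_left (2 * h + 1) hle
        omega
      omega
    subst hc3
    exact hc2 (by omega) ⟨h / 2, by omega⟩ (by omega)
end
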